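/- arXiv:1905.13595 — 3 statements merged into one kernel-verified Lean document; each statement's English description precedes it below -/
import Mathlib

section
/- Let G be a connected simple graph with the path metric in which every edge has length 1, and let k ≥ 0. If every geodesic triangle in G is k-centered (i.e., for every geodesic triangle there is a vertex of G whose distance to each of the three sides is at most k), then every geodesic triangle in G is 4k-thin (i.e., each side of every geodesic triangle is contained in the 4k-neighborhood of the union of the other two sides). -/
namespace SimpleGraph

variable {V : Type*} {G : SimpleGraph V}

/-- Every geodesic triangle of `G` has a `K`-center. -/
def TrianglesCentered (G : SimpleGraph V) (K : ℕ) : Prop :=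
  ∀ (a b c : V) (w₁ : G.Walk a b) (w₂ : G.Walk b c) (w₃ : G.Walk c a),
    w₁.length = G.dist a b → w₂.length = G.dist b c → w₃.length = G.dist c a →
    ∃ z : V, (∃ p ∈ w₁.support, G.dist z p ≤ K) ∧ (∃ p ∈ w₂.support, G.dist z p ≤ K) ∧
      (∃ p ∈ w₃.support, G.dist z p ≤ K)

lemma dist_getVert_of_length_eq_dist {a b : V} {w : G.Walk a b} (hw : w.length = G.dist a b)
    {i j : ℕ} (hij : i ≤ j) (hj : j ≤ w.length) :
    G.dist (w.getVert i) (w.getVert j) = j - i := by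
  have h := length_eq_dist_of_subwalk hw
    (((w.drop i).isSubwalk_take (j - i)).trans (w.isSubwalk_drop i))
  rw [Walk.take_length, Walk.drop_length, Walk.drop_getVert, Nat.add_sub_cancel' hij] at h
  omega

lemma dist_add_dist_of_mem_support {a b u : V} {w : G.Walk a b} (hw : w.length = G.dist a b)
    (hu : u ∈ w.support) : G.dist a u + G.dist u b = G.dist a b := by
  classical
  rw [← length_eq_dist_of_subwalk hw (w.isSubwalk_takeUntil hu),
    ← length_eq_dist_of_subwalk hw (w.isSubwalk_dropUntil hu), ← hw, ← Walk.length_append,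
    Walk.take_spec]

lemma Connected.dist_le_add (hG : G.Connected) {z p q : V} {K L : ℕ} (hp : G.dist z p ≤ K)
    (hq : G.dist z q ≤ L) : G.dist p q ≤ K + L := by
  have := hG.dist_triangle (u := p) (v := z) (w := q)
  rw [G.dist_comm (u := p) (v := z)] at this
  omega

/-- If two geodesics issue from `a`, and a point of the first beyond its `i`-th vertex is
`2 * K`-close to the second, then so is the `i`-th vertex, up to doubling the bound. -/
lemma TrianglesCentered.exists_dist_getVert_le {K : ℕ} (hK : G.TrianglesCentered K)
    (hG : G.Connected) {a b c : V} {w : G.Walk a b} {w' : G.Walk c a}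
    (hw : w.length = G.dist a b) (hw' : w'.length = G.dist c a) {i j : ℕ} (hij : i ≤ j)
    (hj : j ≤ w.length) {v : V} (hv : v ∈ w'.support) (hjv : G.dist (w.getVert j) v ≤ 2 * K) :
    ∃ q ∈ w'.support, G.dist (w.getVert i) q ≤ 4 * K := by
  classical
  induction j using Nat.strong_induction_on generalizing v with
  | _ j ih =>
  obtain rfl | hlt := hij.eq_or_lt
  · exact ⟨v, hv, by omega⟩
  obtain ⟨j, rfl⟩ : ∃ n, j = n + 1 := ⟨j - 1, by omega⟩
  obtain ⟨g, hg⟩ := hG.exists_walk_length_eq_dist (w.getVert j) v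
  obtain ⟨z, ⟨s, hs, hzs⟩, ⟨u, hu, hzu⟩, ⟨t, ht, hzt⟩⟩ := hK _ _ _ (w.take j) g
    (w'.dropUntil v hv) (length_eq_dist_of_subwalk hw (w.isSubwalk_take j)) hg
    (length_eq_dist_of_subwalk hw' (w'.isSubwalk_dropUntil hv))
  replace ht := w'.support_dropUntil_subset_support hv ht
  obtain ⟨m, rfl, hm⟩ := Walk.mem_support_iff_exists_getVert.1 hs
  rw [Walk.take_length] at hm
  rw [Walk.take_getVert, min_eq_right (by omega)] at hzs
  have hst := hG.dist_le_add hzs hzt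
  have hsu := hG.dist_le_add hzs hzu
  obtain him | hmi := le_or_gt i m
  · exact ih m (by omega) him (by omega) ht (by omega)
  have hguv := dist_add_dist_of_mem_support hg hu
  have hstep := dist_getVert_of_length_eq_dist hw (i := j) (j := j + 1) (by omega) hj
  have hmj := dist_getVert_of_length_eq_dist hw (i := m) (j := j) (by omega) (by omega)
  have hmj' := dist_getVert_of_length_eq_dist hw (i := m) (j := j + 1) (by omega) hj
  have hmi' := dist_getVert_of_length_eq_dist hw (i := m) (j := i) (by omega) (by omega)
  have hij' := dist_getVert_of_length_eq_dist hw hij hj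
  have h₁ := hG.dist_triangle (u := w.getVert j) (v := w.getVert (j + 1)) (w := v)
  have h₂ := hG.dist_triangle (u := w.getVert m) (v := u) (w := w.getVert j)
  have h₃ := hG.dist_triangle (u := w.getVert m) (v := u) (w := v)
  have h₄ := hG.dist_triangle (u := w.getVert m) (v := v) (w := w.getVert (j + 1))
  rw [G.dist_comm (u := u) (v := w.getVert j)] at h₂
  rw [G.dist_comm (u := v) (v := w.getVert (j + 1))] at h₄
  have hcases : G.dist (w.getVert m) (w.getVert i) ≤ 2 * K ∨
      G.dist (w.getVert i) (w.getVert (j + 1)) ≤ 2 * K := by omega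
  obtain h | h := hcases
  · exact ⟨t, ht, by have := hG.dist_le_add h hst; omega⟩
  · rw [G.dist_comm] at h
    exact ⟨v, hv, by have := hG.dist_le_add h hjv; omega⟩

lemma TrianglesCentered.exists_dist_le {K : ℕ} (hK : G.TrianglesCentered K)
    (hG : G.Connected) {a b c : V} {w₁ : G.Walk a b} {w₂ : G.Walk b c} {w₃ : G.Walk c a}
    (h₁ : w₁.length = G.dist a b) (h₂ : w₂.length = G.dist b c) (h₃ : w₃.length = G.dist c a)
    {p : V} (hp : p ∈ w₁.support) :
    ∃ q, (q ∈ w₂.support ∨ q ∈ w₃.support) ∧ G.dist p q ≤ 4 * K := by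
  obtain ⟨z, ⟨s, hs, hzs⟩, ⟨u, hu, hzu⟩, ⟨v, hv, hzv⟩⟩ := hK _ _ _ w₁ w₂ w₃ h₁ h₂ h₃
  obtain ⟨i, rfl, hi⟩ := Walk.mem_support_iff_exists_getVert.1 hp
  obtain ⟨j, rfl, hj⟩ := Walk.mem_support_iff_exists_getVert.1 hs
  have hsv := hG.dist_le_add hzs hzv
  have hsu := hG.dist_le_add hzs hzu
  obtain hij | hji := le_total i j
  · obtain ⟨q, hq, hd⟩ := hK.exists_dist_getVert_le hG h₁ h₃ hij hj hv (by omega)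
    exact ⟨q, Or.inr hq, hd⟩
  · obtain ⟨q, hq, hd⟩ := hK.exists_dist_getVert_le hG (w := w₁.reverse) (w' := w₂.reverse)
      (i := w₁.length - i) (j := w₁.length - j) (v := u)
      (by rw [Walk.length_reverse, h₁, G.dist_comm]) (by rw [Walk.length_reverse, h₂, G.dist_comm])
      (by omega) (by rw [Walk.length_reverse]; omega) (by simpa using hu)
      (by rw [Walk.getVert_reverse, Nat.sub_sub_self hj]; omega)
    rw [Walk.getVert_reverse, Nat.sub_sub_self hi] at hd
    exact ⟨q, Or.inl (by simpa using hq), hd⟩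

end SimpleGraph

/-- In a connected simple graph with the path metric (each edge of
length 1), if every geodesic triangle is `k`-centered (there is a vertex whose
distance to each of the three sides is at most `k`), then every geodesic
triangle is `4k`-thin (each side is contained in the `4k`-neighborhood of the
union of the other two sides). -/
theorem centered_implies_thin_graph {V : Type*} (G : SimpleGraph V)
    (hG : G.Connected) (k : ℝ) (hk : 0 ≤ k)
    (hcent : ∀ (a b c : V) (w₁ : G.Walk a b) (w₂ : G.Walk b c) (w₃ : G.Walk c a),
      w₁.length = G.dist a b → w₂.length = G.dist b c → w₃.length = G.dist c a →
      ∃ z : V,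
        (∃ p ∈ w₁.support, (G.dist z p : ℝ) ≤ k) ∧
        (∃ p ∈ w₂.support, (G.dist z p : ℝ) ≤ k) ∧
        (∃ p ∈ w₃.support, (G.dist z p : ℝ) ≤ k)) :
    ∀ (a b c : V) (w₁ : G.Walk a b) (w₂ : G.Walk b c) (w₃ : G.Walk c a),
      w₁.length = G.dist a b → w₂.length = G.dist b c → w₃.length = G.dist c a →
      (∀ p ∈ w₁.support, ∃ q, (q ∈ w₂.support ∨ q ∈ w₃.support) ∧
        (G.dist p q : ℝ) ≤ 4 * k) ∧
      (∀ p ∈ w₂.support, ∃ q, (q ∈ w₃.support ∨ q ∈ w₁.support) ∧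
        (G.dist p q : ℝ) ≤ 4 * k) ∧
      (∀ p ∈ w₃.support, ∃ q, (q ∈ w₁.support ∨ q ∈ w₂.support) ∧
        (G.dist p q : ℝ) ≤ 4 * k) := by
  have hcentered : G.TrianglesCentered ⌊k⌋₊ := by
    simpa only [SimpleGraph.TrianglesCentered, Nat.le_floor_iff hk] using hcent
  have hfloor {n : ℕ} (hn : n ≤ 4 * ⌊k⌋₊) : (n : ℝ) ≤ 4 * k := by
    have : (n : ℝ) ≤ 4 * (⌊k⌋₊ : ℝ) := by exact_mod_cast hn
    linarith [Nat.floor_le hk]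
  intro a b c w₁ w₂ w₃ h₁ h₂ h₃
  refine ⟨fun p hp ↦ ?_, fun p hp ↦ ?_, fun p hp ↦ ?_⟩
  · obtain ⟨q, hq, hd⟩ := hcentered.exists_dist_le hG h₁ h₂ h₃ hp
    exact ⟨q, hq, hfloor hd⟩
  · obtain ⟨q, hq, hd⟩ := hcentered.exists_dist_le hG h₂ h₃ h₁ hp
    exact ⟨q, hq, hfloor hd⟩
  · obtain ⟨q, hq, hd⟩ := hcentered.exists_dist_le hG h₃ h₁ h₂ hp
    exact ⟨q, hq, hfloor hd⟩
end

section
/- Let X be a geodesic metric space and let k ≥ 0. If every geodesic triangle in X is k-centered (i.e., for every geodesic triangle there is a point of X whose distance to each of the three sides is at most k), then every geodesic triangle in X is 4k-thin (i.e., each side of every geodesic triangle is contained in the closed 4k-neighborhood of the union of the other two sides). -/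
/-- A set `s` in a metric space is a geodesic segment from `a` to `b` if it is
the image of an isometric embedding of the interval `[0, dist a b]` sending the
endpoints to `a` and `b`. -/
def IsGeodesicSegment {X : Type*} [MetricSpace X] (s : Set X) (a b : X) : Prop :=
  ∃ f : ℝ → X,
    (∀ u ∈ Set.Icc (0 : ℝ) (dist a b), ∀ v ∈ Set.Icc (0 : ℝ) (dist a b),
      dist (f u) (f v) = |u - v|) ∧
    f 0 = a ∧ f (dist a b) = b ∧ s = f '' Set.Icc (0 : ℝ) (dist a b)

namespace IsGeodesicSegment

variable {X : Type*} [MetricSpace X] {s : Set X} {a b x y : X}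

theorem left_mem (h : IsGeodesicSegment s a b) : a ∈ s := by
  obtain ⟨f, -, h0, -, rfl⟩ := h
  exact ⟨0, ⟨le_rfl, dist_nonneg⟩, h0⟩

theorem isCompact (h : IsGeodesicSegment s a b) : IsCompact s := by
  obtain ⟨f, hf, -, -, rfl⟩ := h
  refine isCompact_Icc.image_of_continuousOn (LipschitzOnWith.continuousOn (K := 1) ?_)
  refine LipschitzOnWith.of_dist_le_mul fun u hu v hv => ?_
  simp [hf u hu v hv, Real.dist_eq]

theorem symm (h : IsGeodesicSegment s a b) : IsGeodesicSegment s b a := by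
  obtain ⟨f, hf, h0, h1, rfl⟩ := h
  have flip_mem : ∀ u ∈ Set.Icc 0 (dist a b), dist a b - u ∈ Set.Icc 0 (dist a b) :=
    fun u hu => ⟨by linarith [hu.2], by linarith [hu.1]⟩
  refine ⟨fun u => f (dist a b - u), ?_, by simpa using h1, by simpa [dist_comm b a] using h0, ?_⟩
  · rw [dist_comm b a]
    intro u hu v hv
    rw [hf _ (flip_mem u hu) _ (flip_mem v hv), abs_sub_comm]
    congr 1
    ring
  · rw [dist_comm b a]
    ext p
    constructor
    · rintro ⟨u, hu, rfl⟩
      exact ⟨dist a b - u, flip_mem u hu, by simp⟩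
    · rintro ⟨u, hu, rfl⟩
      exact ⟨dist a b - u, flip_mem u hu, rfl⟩

theorem dist_eq_abs_sub (h : IsGeodesicSegment s a b) (hx : x ∈ s) (hy : y ∈ s) :
    dist x y = |dist a x - dist a y| := by
  obtain ⟨f, hf, h0, -, rfl⟩ := h
  obtain ⟨u, hu, rfl⟩ := hx
  obtain ⟨v, hv, rfl⟩ := hy
  have dist_left : ∀ w ∈ Set.Icc 0 (dist a b), dist a (f w) = w := fun w hw => by
    rw [← h0, hf 0 ⟨le_rfl, dist_nonneg⟩ w hw, zero_sub, abs_neg, abs_of_nonneg hw.1]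
  rw [hf u hu v hv, dist_left u hu, dist_left v hv]

theorem dist_left_le (h : IsGeodesicSegment s a b) (hx : x ∈ s) : dist a x ≤ dist a b := by
  obtain ⟨f, hf, h0, -, rfl⟩ := h
  obtain ⟨u, hu, rfl⟩ := hx
  have := hf 0 ⟨le_rfl, dist_nonneg⟩ u hu
  rw [h0, zero_sub, abs_neg, abs_of_nonneg hu.1] at this
  exact this.trans_le hu.2

theorem exists_dist_left_eq (h : IsGeodesicSegment s a b) {t : ℝ} (ht : 0 ≤ t)
    (htb : t ≤ dist a b) : ∃ z ∈ s, dist a z = t := by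
  obtain ⟨f, hf, h0, -, rfl⟩ := h
  refine ⟨f t, ⟨t, ⟨ht, htb⟩, rfl⟩, ?_⟩
  rw [← h0, hf 0 ⟨le_rfl, dist_nonneg⟩ t ⟨ht, htb⟩, zero_sub, abs_neg, abs_of_nonneg ht]

theorem initial_segment (h : IsGeodesicSegment s a b) (hx : x ∈ s) :
    IsGeodesicSegment {p ∈ s | dist a p ≤ dist a x} a x := by
  obtain ⟨f, hf, h0, -, rfl⟩ := h
  have dist_left : ∀ w ∈ Set.Icc 0 (dist a b), dist a (f w) = w := fun w hw => by
    rw [← h0, hf 0 ⟨le_rfl, dist_nonneg⟩ w hw, zero_sub, abs_neg, abs_of_nonneg hw.1]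
  obtain ⟨u, hu, rfl⟩ := hx
  rw [dist_left u hu]
  have mono : ∀ v ∈ Set.Icc 0 u, v ∈ Set.Icc 0 (dist a b) :=
    fun v hv => ⟨hv.1, hv.2.trans hu.2⟩
  refine ⟨f, ?_, h0, ?_, ?_⟩
  · rw [dist_left u hu]
    exact fun v hv w hw => hf v (mono v hv) w (mono w hw)
  · rw [dist_left u hu]
  · rw [dist_left u hu]
    ext p
    constructor
    · rintro ⟨⟨v, hv, rfl⟩, hvu⟩
      exact ⟨v, ⟨hv.1, dist_left v hv ▸ hvu⟩, rfl⟩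
    · rintro ⟨v, hv, rfl⟩
      exact ⟨⟨v, mono v hv, rfl⟩, (dist_left v (mono v hv)).trans_le hv.2⟩

theorem exists_dist_le_of_infDist_le (h : IsGeodesicSegment s a b) {p : X} {k : ℝ}
    (hp : Metric.infDist p s ≤ k) : ∃ z ∈ s, dist p z ≤ k := by
  obtain ⟨z, hz, hpz⟩ := h.isCompact.exists_infDist_eq_dist ⟨a, h.left_mem⟩ p
  exact ⟨z, hz, hpz ▸ hp⟩

end IsGeodesicSegment

/-- Every geodesic triangle has a point at distance at most `k` from each of its sides. -/
def TrianglesCentered (X : Type*) [MetricSpace X] (k : ℝ) : Prop :=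
  ∀ (a b c : X) (s₁ s₂ s₃ : Set X),
    IsGeodesicSegment s₁ a b → IsGeodesicSegment s₂ b c → IsGeodesicSegment s₃ c a →
    ∃ p : X, Metric.infDist p s₁ ≤ k ∧ Metric.infDist p s₂ ≤ k ∧ Metric.infDist p s₃ ≤ k

namespace TrianglesCentered

variable {X : Type*} [MetricSpace X] {k : ℝ} {a b c : X} {s₁ s₂ s₃ : Set X}

/-- The sides of a `k`-centered triangle contain points pairwise at distance at most `2 * k`. -/
theorem exists_close_points (hcent : TrianglesCentered X k) (h₁ : IsGeodesicSegment s₁ a b)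
    (h₂ : IsGeodesicSegment s₂ b c) (h₃ : IsGeodesicSegment s₃ c a) :
    ∃ z ∈ s₁, ∃ q ∈ s₂, ∃ w ∈ s₃, dist z q ≤ 2 * k ∧ dist z w ≤ 2 * k := by
  obtain ⟨p, hp₁, hp₂, hp₃⟩ := hcent a b c s₁ s₂ s₃ h₁ h₂ h₃
  obtain ⟨z, hz, hpz⟩ := h₁.exists_dist_le_of_infDist_le hp₁
  obtain ⟨q, hq, hpq⟩ := h₂.exists_dist_le_of_infDist_le hp₂
  obtain ⟨w, hw, hpw⟩ := h₃.exists_dist_le_of_infDist_le hp₃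
  exact ⟨z, hz, q, hq, w, hw, by linarith [dist_triangle_left z q p],
    by linarith [dist_triangle_left z w p]⟩

/-- If two geodesics start at `a` and a point of the first beyond `x` is `2 * k`-close to the
second, then `x` is within any distance exceeding `4 * k` of the second. -/
theorem exists_dist_le_of_fellow (hcent : TrianglesCentered X k)
    (hgeo : ∀ a b : X, ∃ s : Set X, IsGeodesicSegment s a b) (hk : 0 ≤ k)
    (h₁ : IsGeodesicSegment s₁ a b) (h₃ : IsGeodesicSegment s₃ a c) {x x' y : X}
    (hx : x ∈ s₁) (hx' : x' ∈ s₁) (hxx' : dist a x ≤ dist a x') (hy : y ∈ s₃)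
    (hxy : dist x' y ≤ 2 * k) {ε : ℝ} (hε : 0 < ε) :
    ∃ w ∈ s₃, dist x w ≤ 4 * k + ε := by
  let T : Set ℝ :=
    {t | ∃ u ∈ s₁, ∃ v ∈ s₃, dist a x ≤ dist a u ∧ dist u v ≤ 2 * k ∧ dist a v = t}
  have hTbdd : BddBelow T := ⟨0, by rintro _ ⟨u, -, v, -, -, -, rfl⟩; exact dist_nonneg⟩
  have hTne : T.Nonempty := ⟨_, x', hx', y, hy, hxx', hxy, rfl⟩
  obtain ⟨_, ⟨u, hu, v, hv, hxu, huv, rfl⟩, hlt⟩ :=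
    exists_lt_of_csInf_lt hTne (lt_add_of_pos_right (sInf T) hε)
  rcases le_total (dist a v) ε with hsmall | hlarge
  · refine ⟨a, h₃.left_mem, ?_⟩
    linarith [dist_comm x a, dist_triangle a v u, dist_comm u v]
  obtain ⟨v', hv', hav'⟩ := h₃.exists_dist_left_eq (t := dist a v - ε) (by linarith)
    (by linarith [h₃.dist_left_le hv])
  have hvv' : dist v v' = ε := by
    rw [h₃.dist_eq_abs_sub hv hv', hav', sub_sub_cancel, abs_of_pos hε]
  obtain ⟨r, hr⟩ := hgeo u v'
  obtain ⟨z, hz, q, hq, w, hw, hzq, hzw⟩ :=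
    hcent.exists_close_points (h₁.initial_segment hu) hr (h₃.initial_segment hv').symm
  have hzx : dist a z < dist a x := by
    by_contra! hxz
    have := csInf_le hTbdd ⟨z, hz.1, w, hw.1, hxz, hzw, rfl⟩
    linarith [hw.2]
  have hzu : dist z u ≤ 4 * k + ε := by
    linarith [dist_triangle z q u, dist_comm q u, hr.dist_left_le hq, dist_triangle u v v']
  have hsplit : dist z x + dist x u = dist z u := by
    rw [h₁.dist_eq_abs_sub hz.1 hx, h₁.dist_eq_abs_sub hx hu, h₁.dist_eq_abs_sub hz.1 hu,
      abs_of_nonpos (by linarith), abs_of_nonpos (by linarith), abs_of_nonpos (by linarith)]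
    ring
  rcases le_total (dist x u) (2 * k) with hnear | hfar
  · exact ⟨v, hv, by linarith [dist_triangle x u v]⟩
  · exact ⟨w, hw.1, by linarith [dist_triangle x z w, dist_comm x z]⟩

theorem side_subset_cthickening (hcent : TrianglesCentered X k)
    (hgeo : ∀ a b : X, ∃ s : Set X, IsGeodesicSegment s a b) (hk : 0 ≤ k)
    (h₁ : IsGeodesicSegment s₁ a b) (h₂ : IsGeodesicSegment s₂ b c)
    (h₃ : IsGeodesicSegment s₃ c a) : s₁ ⊆ Metric.cthickening (4 * k) (s₂ ∪ s₃) := by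
  intro x hx
  suffices h : Metric.infDist x (s₂ ∪ s₃) ≤ 4 * k from
    (ENNReal.le_ofReal_iff_toReal_le (Metric.infEDist_ne_top ⟨b, Or.inl h₂.left_mem⟩)
      (by positivity)).2 h
  refine le_of_forall_pos_le_add fun ε hε => ?_
  obtain ⟨z, hz, q, hq, w, hw, hzq, hzw⟩ := hcent.exists_close_points h₁ h₂ h₃
  rcases le_total (dist a x) (dist a z) with hxz | hzx
  · obtain ⟨y, hy, hxy⟩ :=
      hcent.exists_dist_le_of_fellow hgeo hk h₁ h₃.symm hx hz hxz hw hzw hε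
    exact (Metric.infDist_le_dist_of_mem (Set.mem_union_right _ hy)).trans hxy
  · have hbxz : dist b x ≤ dist b z := by
      have hb := h₁.symm.left_mem
      rw [h₁.dist_eq_abs_sub hb hx, h₁.dist_eq_abs_sub hb hz,
        abs_of_nonneg (sub_nonneg.2 (h₁.dist_left_le hx)),
        abs_of_nonneg (sub_nonneg.2 (h₁.dist_left_le hz))]
      linarith
    obtain ⟨y, hy, hxy⟩ :=
      hcent.exists_dist_le_of_fellow hgeo hk h₁.symm h₂ hx hz hbxz hq hzq hε
    exact (Metric.infDist_le_dist_of_mem (Set.mem_union_left _ hy)).trans hxy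

end TrianglesCentered

/-- In a geodesic metric space, if every geodesic triangle is
`k`-centered (there is a point whose distance to each of the three sides is at
most `k`), then every geodesic triangle is `4k`-thin (each side is contained in
the closed `4k`-neighborhood of the union of the other two sides). -/
theorem centered_implies_thin_geodesic_space {X : Type*} [MetricSpace X]
    (hgeo : ∀ a b : X, ∃ s : Set X, IsGeodesicSegment s a b)
    (k : ℝ) (hk : 0 ≤ k)
    (hcent : ∀ (a b c : X) (s₁ s₂ s₃ : Set X),
      IsGeodesicSegment s₁ a b → IsGeodesicSegment s₂ b c →
      IsGeodesicSegment s₃ c a →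
      ∃ p : X, Metric.infDist p s₁ ≤ k ∧ Metric.infDist p s₂ ≤ k ∧
        Metric.infDist p s₃ ≤ k) :
    ∀ (a b c : X) (s₁ s₂ s₃ : Set X),
      IsGeodesicSegment s₁ a b → IsGeodesicSegment s₂ b c →
      IsGeodesicSegment s₃ c a →
      s₁ ⊆ Metric.cthickening (4 * k) (s₂ ∪ s₃) ∧
      s₂ ⊆ Metric.cthickening (4 * k) (s₃ ∪ s₁) ∧
      s₃ ⊆ Metric.cthickening (4 * k) (s₁ ∪ s₂) := by
  intro a b c s₁ s₂ s₃ h₁ h₂ h₃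
  have hcentered : TrianglesCentered X k := hcent
  exact ⟨hcentered.side_subset_cthickening hgeo hk h₁ h₂ h₃,
    hcentered.side_subset_cthickening hgeo hk h₂ h₃ h₁,
    hcentered.side_subset_cthickening hgeo hk h₃ h₁ h₂⟩
end

section
/- Let h ≥ 0 and let G be a connected simple graph with vertex set V(G), equipped with the path metric d in which every edge has length 1. Suppose that to each pair of vertices x, y ∈ V(G) is associated a connected subgraph L(x,y) of G with x, y ∈ L(x,y), such that: (1) for all x, y, z ∈ V(G), every vertex of L(x,y) lies within distance h of some vertex of L(x,z) ∪ L(z,y); and (2) for any x, y ∈ V(G) with d(x,y) ≤ 1, the diameter of the vertex set of L(x,y) in G is at most h. Then for any real m > 0 satisfying 2h(6 + log₂(m+2)) ≤ m and any δ ≥ (3m − 10h)/2, every geodesic triangle in G is δ-thin; in particular G is δ-thin hyperbolic. -/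
namespace SimpleGraph

variable {V : Type*} {G : SimpleGraph V}

/-- A family of connected subgraphs `L x y` joining `x` to `y`, forming `H`-thin triangles, and
having diameter at most `H` when `x` and `y` are at distance at most one. -/
structure IsThinFamily (G : SimpleGraph V) (L : V → V → G.Subgraph) (H : ℕ) : Prop where
  conn : G.Connected
  subgraph_conn : ∀ x y, (L x y).Connected
  left_mem : ∀ x y, x ∈ (L x y).verts
  right_mem : ∀ x y, y ∈ (L x y).verts
  thin : ∀ x y z, ∀ v ∈ (L x y).verts,
    ∃ w, (w ∈ (L x z).verts ∨ w ∈ (L z y).verts) ∧ G.dist v w ≤ H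
  diam_le : ∀ x y, G.dist x y ≤ 1 → ∀ u ∈ (L x y).verts, ∀ v ∈ (L x y).verts, G.dist u v ≤ H

/-- The vertex sequence `γ` restricted to `{0, …, n}` is a geodesic. -/
def IsGeodesicSeq (G : SimpleGraph V) (γ : ℕ → V) (n : ℕ) : Prop :=
  ∀ s t, s ≤ t → t ≤ n → s + G.dist (γ s) (γ t) = t

/-- For every subsegment of `γ` in `{0, …, n}`, the corresponding member of the family `L` lies in
the `l`-neighbourhood of that subsegment. -/
def TracksSegments (L : V → V → G.Subgraph) (γ : ℕ → V) (n l : ℕ) : Prop :=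
  ∀ i j, i ≤ j → j ≤ n → ∀ w ∈ (L (γ i) (γ j)).verts,
    ∃ t, i ≤ t ∧ t ≤ j ∧ G.dist w (γ t) ≤ l

lemma Walk.isGeodesicSeq_getVert {x y : V} (hG : G.Connected) (p : G.Walk x y)
    (hp : p.length = G.dist x y) : G.IsGeodesicSeq p.getVert p.length := by
  have upper : ∀ s k, s + k ≤ p.length → G.dist (p.getVert s) (p.getVert (s + k)) ≤ k := by
    intro s k
    induction k with
    | zero => simp
    | succ k ih =>
      intro hk
      have adj := p.adj_getVert_succ (i := s + k) (by omega)
      have := hG.dist_triangle (u := p.getVert s) (v := p.getVert (s + k))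
        (w := p.getVert (s + k + 1))
      rw [dist_eq_one_iff_adj.2 adj] at this
      have := ih (by omega)
      rw [← add_assoc]
      omega
  intro s t hst ht
  have a := upper 0 s (by omega)
  have b := upper s (t - s) (by omega)
  have c := upper t (p.length - t) (by omega)
  rw [zero_add, p.getVert_zero] at a
  rw [Nat.add_sub_cancel' hst] at b
  rw [Nat.add_sub_cancel' ht, p.getVert_length] at c
  have d := hG.dist_triangle (u := x) (v := p.getVert s) (w := y)
  have e := hG.dist_triangle (u := p.getVert s) (v := p.getVert t) (w := y)
  omega

namespace IsThinFamily

variable {L : V → V → G.Subgraph} {H : ℕ} {γ : ℕ → V} {n : ℕ}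

lemma exists_dist_le_of_le_two_pow (hL : G.IsThinFamily L H) (hγ : G.IsGeodesicSeq γ n) (k : ℕ) :
    ∀ i j, i ≤ j → j ≤ n → j ≤ i + 2 ^ k → ∀ w ∈ (L (γ i) (γ j)).verts,
      ∃ t, i ≤ t ∧ t ≤ j ∧ G.dist w (γ t) ≤ (k + 1) * H := by
  induction k with
  | zero =>
    intro i j hij hj hk w hw
    have := hγ i j hij hj
    refine ⟨i, le_rfl, hij, ?_⟩
    simpa using hL.diam_le (γ i) (γ j) (by omega) w hw _ (hL.left_mem _ _)
  | succ k ih =>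
    intro i j hij hj hk w hw
    rw [pow_succ] at hk
    obtain ⟨w', hw', hd⟩ := hL.thin (γ i) (γ j) (γ ((i + j) / 2)) w hw
    have key : ∃ t, i ≤ t ∧ t ≤ j ∧ G.dist w' (γ t) ≤ (k + 1) * H := by
      rcases hw' with hw' | hw'
      · obtain ⟨t, h1, h2, h3⟩ := ih i ((i + j) / 2) (by omega) (by omega) (by omega) w' hw'
        exact ⟨t, h1, by omega, h3⟩
      · obtain ⟨t, h1, h2, h3⟩ := ih ((i + j) / 2) j (by omega) (by omega) (by omega) w' hw'
        exact ⟨t, by omega, h2, h3⟩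
    obtain ⟨t, h1, h2, h3⟩ := key
    refine ⟨t, h1, h2, ?_⟩
    have := hL.conn.dist_triangle (u := w) (v := w') (w := γ t)
    rw [add_mul (k + 1) 1 H]
    omega

/-- A tracking constant `l` can be replaced by one that is logarithmic in `l`. -/
lemma tracksSegments_of_le_two_pow (hL : G.IsThinFamily L H) (hγ : G.IsGeodesicSeq γ n) {l k : ℕ}
    (hl : TracksSegments L γ n l) (hk : 2 * l + 3 * H + 2 ≤ 2 ^ k) :
    TracksSegments L γ n ((k + 3) * H) := by
  classical
  intro i j hij hj w hw
  have hexp : (k + 3) * H = (k + 1) * H + 2 * H := by ring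
  have tri : ∀ x y z, G.dist x z ≤ G.dist x y + G.dist y z :=
    fun x y z => hL.conn.dist_triangle
  have hex : ∃ r, i ≤ r ∧ ∃ w' ∈ (L (γ i) (γ r)).verts, G.dist w w' ≤ H :=
    ⟨j, hij, w, hw, by simp⟩
  obtain ⟨hir, w', hw', hww'⟩ := Nat.find_spec hex
  have hrj : Nat.find hex ≤ j := Nat.find_min' hex ⟨hij, w, hw, by simp⟩
  have hmin : ∀ r < Nat.find hex, ¬ (i ≤ r ∧ ∃ w' ∈ (L (γ i) (γ r)).verts, G.dist w w' ≤ H) :=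
    fun r hr => Nat.find_min hex hr
  generalize Nat.find hex = r at *
  by_cases hshort : r ≤ i + 2 ^ k
  · obtain ⟨t, h1, h2, h3⟩ :=
      hL.exists_dist_le_of_le_two_pow hγ k i r hir (by omega) hshort w' hw'
    refine ⟨t, h1, by omega, ?_⟩
    have := tri w w' (γ t)
    omega
  · obtain ⟨b, hrb, hbj, hb⟩ : ∃ b, r - 1 ≤ b ∧ b ≤ j ∧ G.dist w (γ b) ≤ H + l := by
      obtain ⟨v, hv, hwv⟩ := hL.thin (γ i) (γ j) (γ (r - 1)) w hw
      rcases hv with hv | hv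
      · exact absurd ⟨by omega, v, hv, hwv⟩ (hmin (r - 1) (by omega))
      · obtain ⟨b, h1, h2, h3⟩ := hl (r - 1) j (by omega) hj v hv
        have := tri w v (γ b)
        exact ⟨b, h1, h2, by omega⟩
    obtain ⟨v, hv, hwv⟩ := hL.thin (γ i) (γ r) (γ (r - 2 ^ k)) w' hw'
    have hwv' := tri w w' v
    rcases hv with hv | hv
    · obtain ⟨a, h1, h2, h3⟩ := hl i (r - 2 ^ k) (by omega) (by omega) v hv
      have h4 := tri w v (γ a)
      have h5 := tri (γ a) w (γ b)
      have h6 := hγ a b (by omega) (by omega)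
      rw [G.dist_comm (u := γ a) (v := w)] at h5
      omega
    · obtain ⟨t, h1, h2, h3⟩ :=
        hL.exists_dist_le_of_le_two_pow hγ k (r - 2 ^ k) r (by omega) (by omega) (by omega) v hv
      have := tri w v (γ t)
      exact ⟨t, by omega, by omega, by omega⟩

/-- A tracking constant `l` satisfying a logarithmic self-bound exists. -/
lemma exists_tracksSegments (hL : G.IsThinFamily L H) (hγ : G.IsGeodesicSeq γ n) :
    ∃ l : ℕ, TracksSegments L γ n l ∧ (l : ℝ) ≤ H * (4 + Real.logb 2 (2 * l + 3 * H + 2)) := by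
  classical
  have hex : ∃ l, TracksSegments L γ n l := by
    refine ⟨(n + 1) * H, fun i j hij hj w hw => ?_⟩
    exact hL.exists_dist_le_of_le_two_pow hγ n i j hij hj
      (by have := (Nat.lt_two_pow_self (n := n)); omega) w hw
  have hl := Nat.find_spec hex
  have hmin : ∀ l', TracksSegments L γ n l' → Nat.find hex ≤ l' := fun l' h => Nat.find_min' hex h
  generalize Nat.find hex = l at *
  refine ⟨l, hl, ?_⟩
  have hle := hmin _ (hL.tracksSegments_of_le_two_pow hγ hl (Nat.le_pow_clog one_lt_two _))
  have hlt := Nat.pow_pred_clog_lt_self (b := 2) one_lt_two (x := 2 * l + 3 * H + 2) (by omega)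
  have hpos := Nat.clog_pos (b := 2) one_lt_two (n := 2 * l + 3 * H + 2) (by omega)
  generalize Nat.clog 2 (2 * l + 3 * H + 2) = k at *
  obtain ⟨k, rfl⟩ : ∃ k', k = k' + 1 := ⟨k - 1, by omega⟩
  rw [Nat.pred_succ] at hlt
  have hk : (k : ℝ) ≤ Real.logb 2 (2 * l + 3 * H + 2) := by
    rw [Real.le_logb_iff_rpow_le one_lt_two (by positivity), Real.rpow_natCast]
    exact_mod_cast hlt.le
  calc (l : ℝ) ≤ ((k + 1 + 3) * H : ℕ) := by exact_mod_cast hle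
    _ = H * (4 + k) := by push_cast; ring
    _ ≤ _ := by gcongr

/-- A geodesic lies in the `2 * l`-neighbourhood of a family member which lies in its
`l`-neighbourhood. -/
lemma exists_mem_dist_le_two_mul (hL : G.IsThinFamily L H) (hγ : G.IsGeodesicSeq γ n) {l : ℕ}
    (hl : TracksSegments L γ n l) {t : ℕ} (ht : t ≤ n) :
    ∃ v ∈ (L (γ 0) (γ n)).verts, G.dist (γ t) v ≤ 2 * l := by
  have tri : ∀ x y z, G.dist x z ≤ G.dist x y + G.dist y z :=
    fun x y z => hL.conn.dist_triangle
  let S : Set (L (γ 0) (γ n)).verts := {v | ∃ a ≤ t, G.dist v.1 (γ a) ≤ l}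
  by_cases hn : (⟨γ n, hL.right_mem _ _⟩ : (L (γ 0) (γ n)).verts) ∈ S
  · obtain ⟨a, hat, ha⟩ := hn
    refine ⟨γ n, hL.right_mem _ _, ?_⟩
    have h1 := hγ t n ht le_rfl
    have h2 := hγ a n (by omega) le_rfl
    rw [G.dist_comm] at ha
    dsimp only at ha
    omega
  · obtain ⟨p⟩ := (hL.subgraph_conn (γ 0) (γ n)).preconnected
      ⟨γ 0, hL.left_mem _ _⟩ ⟨γ n, hL.right_mem _ _⟩
    obtain ⟨d, -, ⟨a, hat, ha⟩, hd⟩ := p.exists_boundary_dart S ⟨0, by omega, by simp⟩ hn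
    obtain ⟨b, -, hbn, hb⟩ := hl 0 n (by omega) le_rfl d.snd.1 d.snd.2
    have hbt : t < b := by
      by_contra hbt
      exact hd ⟨b, by omega, hb⟩
    have hadj : G.dist d.fst.1 d.snd.1 = 1 :=
      dist_eq_one_iff_adj.2 ((L (γ 0) (γ n)).adj_sub d.adj)
    have h1 := tri (γ a) d.fst.1 (γ b)
    have h2 := tri d.fst.1 d.snd.1 (γ b)
    have h3 := hγ a b (by omega) hbn
    have h4 := hγ a t hat ht
    have h5 := hγ t b hbt.le hbn
    have h6 := tri (γ t) (γ a) d.fst.1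
    have h7 := tri (γ t) (γ b) d.snd.1
    rw [G.dist_comm (u := γ a) (v := d.fst.1)] at h1 h6
    rw [G.dist_comm (u := γ b) (v := d.snd.1)] at h7
    rw [G.dist_comm (u := γ t) (v := γ a)] at h6
    by_cases hc : G.dist (γ t) d.fst.1 ≤ 2 * l
    · exact ⟨d.fst.1, d.fst.2, hc⟩
    · exact ⟨d.snd.1, d.snd.2, by omega⟩

end IsThinFamily

end SimpleGraph

/-- A quantity bounded logarithmically in terms of itself lies below every point at which the
reverse inequality holds. -/
lemma le_of_two_mul_mul_logb_le {h m M : ℝ} (hh : 0 ≤ h) (hm : 0 < m)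
    (hm' : 2 * h * (6 + Real.logb 2 (m + 2)) ≤ m)
    (hM : M ≤ 2 * h * (6 + Real.logb 2 (M + 2))) : M ≤ m := by
  by_contra! hlt
  have hlog2 : (0.6 : ℝ) < Real.log 2 := by linarith [Real.log_two_gt_d9]
  have hnonneg : 0 ≤ Real.logb 2 (m + 2) := Real.logb_nonneg one_lt_two (by linarith)
  have h12 : 12 * h ≤ m := by nlinarith [mul_nonneg hh hnonneg]
  have hdiff : Real.logb 2 (M + 2) - Real.logb 2 (m + 2) ≤
      (M - m) / ((m + 2) * Real.log 2) := by
    rw [Real.logb, Real.logb, ← sub_div, ← Real.log_div (by linarith) (by linarith), ← div_div]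
    gcongr
    have heq : (M - m) / (m + 2) = (M + 2) / (m + 2) - 1 := by
      have : m + 2 ≠ 0 := by positivity
      field_simp
      ring
    rw [heq]
    exact Real.log_le_sub_one_of_pos (div_pos (by linarith) (by linarith))
  have hpos : 0 < (m + 2) * Real.log 2 := by positivity
  rw [le_div_iff₀ hpos] at hdiff
  have key : 2 * h < (m + 2) * Real.log 2 := by nlinarith
  have hstep : M - m ≤ 2 * h * (Real.logb 2 (M + 2) - Real.logb 2 (m + 2)) := by linarith
  have h1 := mul_le_mul_of_nonneg_right hstep hpos.le
  have h2 := mul_le_mul_of_nonneg_left hdiff (by linarith : 0 ≤ 2 * h)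
  nlinarith [mul_pos (sub_pos.2 hlt) (sub_pos.2 key)]

namespace SimpleGraph.IsThinFamily

variable {V : Type*} {G : SimpleGraph V} {L : V → V → G.Subgraph} {H : ℕ}

lemma exists_walk_tracking (hL : G.IsThinFamily L H) {h m : ℝ} (hH : (H : ℝ) ≤ h) (hm : 0 < m)
    (hm' : 2 * h * (6 + Real.logb 2 (m + 2)) ≤ m) {x y : V} (p : G.Walk x y)
    (hp : p.length = G.dist x y) :
    ∃ l : ℕ, 2 * (l : ℝ) + 4 * h ≤ m ∧
      (∀ v ∈ (L x y).verts, ∃ q ∈ p.support, G.dist v q ≤ l) ∧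
      ∀ q ∈ p.support, ∃ v ∈ (L x y).verts, G.dist q v ≤ 2 * l := by
  have hγ := p.isGeodesicSeq_getVert hL.conn hp
  obtain ⟨l, hl, hbound⟩ := hL.exists_tracksSegments hγ
  have hh : 0 ≤ h := le_trans (by positivity) hH
  refine ⟨l, ?_, fun v hv => ?_, fun q hq => ?_⟩
  · refine le_of_two_mul_mul_logb_le hh hm hm' ?_
    have hlog : Real.logb 2 (2 * l + 3 * H + 2) ≤ Real.logb 2 (2 * l + 4 * h + 2) :=
      Real.logb_le_logb_of_le one_lt_two (by positivity) (by linarith)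
    have hnonneg : 0 ≤ Real.logb 2 (2 * l + 3 * H + 2) :=
      Real.logb_nonneg one_lt_two (by
        have : (0 : ℝ) ≤ l := by positivity
        have : (0 : ℝ) ≤ H := by positivity
        linarith)
    have : (H : ℝ) * (4 + Real.logb 2 (2 * l + 3 * H + 2)) ≤
        h * (4 + Real.logb 2 (2 * l + 4 * h + 2)) := by
      gcongr
    linarith
  · obtain ⟨t, -, -, ht⟩ := hl 0 p.length (by omega) le_rfl v (by simpa using hv)
    exact ⟨p.getVert t, p.getVert_mem_support t, ht⟩
  · obtain ⟨t, rfl, ht⟩ := Walk.mem_support_iff_exists_getVert.1 hq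
    simpa using hL.exists_mem_dist_le_two_mul hγ hl ht

lemma thin_side (hL : G.IsThinFamily L H) {h m δ : ℝ} (hH : (H : ℝ) ≤ h) (hm : 0 < m)
    (hm' : 2 * h * (6 + Real.logb 2 (m + 2)) ≤ m) (hδ : (3 * m - 10 * h) / 2 ≤ δ)
    {a b c : V} (w₁ : G.Walk a b) (w₂ : G.Walk b c) (w₃ : G.Walk c a)
    (hw₁ : w₁.length = G.dist a b) (hw₂ : w₂.length = G.dist b c)
    (hw₃ : w₃.length = G.dist c a) :
    ∀ p ∈ w₁.support, ∃ q, (q ∈ w₂.support ∨ q ∈ w₃.support) ∧ (G.dist p q : ℝ) ≤ δ := by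
  intro p hp
  obtain ⟨l₁, hl₁, -, near₁⟩ := hL.exists_walk_tracking hH hm hm' w₁ hw₁
  obtain ⟨l₂, hl₂, near₂, -⟩ := hL.exists_walk_tracking hH hm hm' w₂.reverse
    (by rw [Walk.length_reverse, hw₂, dist_comm])
  obtain ⟨l₃, hl₃, near₃, -⟩ := hL.exists_walk_tracking hH hm hm' w₃.reverse
    (by rw [Walk.length_reverse, hw₃, dist_comm])
  obtain ⟨v, hv, hpv⟩ := near₁ p hp
  obtain ⟨v', hv', hvv'⟩ := hL.thin a b c v hv
  have bound : ∀ (l : ℕ) (q : V), 2 * (l : ℝ) + 4 * h ≤ m → G.dist v' q ≤ l →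
      (G.dist p q : ℝ) ≤ δ := by
    intro l q hl hq
    have t1 := hL.conn.dist_triangle (u := p) (v := v) (w := q)
    have t2 := hL.conn.dist_triangle (u := v) (v := v') (w := q)
    have : G.dist p q ≤ 2 * l₁ + H + l := by omega
    have : (G.dist p q : ℝ) ≤ 2 * l₁ + H + l := by exact_mod_cast this
    linarith
  rcases hv' with hv' | hv'
  · obtain ⟨q, hq, hd⟩ := near₃ v' hv'
    exact ⟨q, Or.inr (by simpa using hq), bound l₃ q hl₃ hd⟩
  · obtain ⟨q, hq, hd⟩ := near₂ v' hv'
    exact ⟨q, Or.inl (by simpa using hq), bound l₂ q hl₂ hd⟩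

end SimpleGraph.IsThinFamily

/-- Bowditch's criterion: Let `h ≥ 0` and let `G` be a connected
simple graph with the path metric. Suppose each pair of vertices `x, y` is
assigned a connected subgraph `L x y` containing `x` and `y` such that
(1) every vertex of `L x y` lies within distance `h` of a vertex of
`L x z ∪ L z y`, and (2) whenever `d(x,y) ≤ 1`, the diameter of the vertex set
of `L x y` is at most `h`. Then for any `m > 0` with `2h(6 + log₂(m+2)) ≤ m`
and any `δ ≥ (3m - 10h)/2`, every geodesic triangle in `G` is `δ`-thin. -/
theorem bowditch_criterion {V : Type*} (G : SimpleGraph V) (hG : G.Connected)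
    (h : ℝ) (hh : 0 ≤ h)
    (L : V → V → G.Subgraph)
    (hLconn : ∀ x y : V, (L x y).Connected)
    (hLx : ∀ x y : V, x ∈ (L x y).verts)
    (hLy : ∀ x y : V, y ∈ (L x y).verts)
    (h1 : ∀ x y z : V, ∀ v ∈ (L x y).verts,
      ∃ w, (w ∈ (L x z).verts ∨ w ∈ (L z y).verts) ∧ (G.dist v w : ℝ) ≤ h)
    (h2 : ∀ x y : V, G.dist x y ≤ 1 →
      ∀ u ∈ (L x y).verts, ∀ v ∈ (L x y).verts, (G.dist u v : ℝ) ≤ h) :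
    ∀ m : ℝ, 0 < m → 2 * h * (6 + Real.logb 2 (m + 2)) ≤ m →
    ∀ δ : ℝ, (3 * m - 10 * h) / 2 ≤ δ →
    ∀ (a b c : V) (w₁ : G.Walk a b) (w₂ : G.Walk b c) (w₃ : G.Walk c a),
      w₁.length = G.dist a b → w₂.length = G.dist b c → w₃.length = G.dist c a →
      (∀ p ∈ w₁.support, ∃ q, (q ∈ w₂.support ∨ q ∈ w₃.support) ∧
        (G.dist p q : ℝ) ≤ δ) ∧
      (∀ p ∈ w₂.support, ∃ q, (q ∈ w₃.support ∨ q ∈ w₁.support) ∧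
        (G.dist p q : ℝ) ≤ δ) ∧
      (∀ p ∈ w₃.support, ∃ q, (q ∈ w₁.support ∨ q ∈ w₂.support) ∧
        (G.dist p q : ℝ) ≤ δ) := by
  intro m hm hm' δ hδ a b c w₁ w₂ w₃ hw₁ hw₂ hw₃
  have hL : G.IsThinFamily L ⌊h⌋₊ :=
    { conn := hG
      subgraph_conn := hLconn
      left_mem := hLx
      right_mem := hLy
      thin := fun x y z v hv =>
        let ⟨w, hw, hd⟩ := h1 x y z v hv
        ⟨w, hw, Nat.le_floor hd⟩
      diam_le := fun x y hxy u hu v hv => Nat.le_floor (h2 x y hxy u hu v hv) }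
  have hH := Nat.floor_le hh
  exact ⟨hL.thin_side hH hm hm' hδ w₁ w₂ w₃ hw₁ hw₂ hw₃,
    hL.thin_side hH hm hm' hδ w₂ w₃ w₁ hw₂ hw₃ hw₁,
    hL.thin_side hH hm hm' hδ w₃ w₁ w₂ hw₃ hw₁ hw₂⟩
end
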